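/- Let R ∈ ℝ^{m×m} be symmetric positive definite, let A : ℝ^d → ℝ^{d×d} and B : ℝ^d → ℝ^{d×m} be continuous, and let P : ℝ^d → ℝ^{d×d} be continuously differentiable with symmetric values. Define φ(y) ∈ ℝ^d by φ(y)_i = yᵀ(∂P/∂y_i)(y)y and the corrected SDRE feedback ũ_S(y) = −(1/2) R⁻¹ B(y)ᵀ ( 2P(y)y + φ(y) ). Assume the matrix A(0) − B(0)R⁻¹B(0)ᵀP(0) is Hurwitz (every complex eigenvalue has negative real part). Then the origin is locally asymptotically stable for the closed-loop system ẏ = A(y)y + B(y)ũ_S(y): there exists δ > 0 such that every differentiable y : [0,∞) → ℝ^d with y′(t) = A(y(t))y(t) + B(y(t))ũ_S(y(t)) for all t ≥ 0 and ‖y(0)‖ ≤ δ satisfies y(t) → 0 as t → ∞. -/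

import Mathlib

open Matrix Filter

theorem lyap_functionals (n : ℕ) : ∀ (V : Type) [AddCommGroup V] [Module ℂ V] [FiniteDimensional ℂ V]
    (T : V →ₗ[ℂ] V), Module.finrank ℂ V = n → (∀ μ : ℂ, ∀ x : V, x ≠ 0 → T x = μ • x → μ.re < 0) →
    ∃ (l : Fin n → V →ₗ[ℂ] ℂ) (c : ℝ), 0 < c ∧ (∀ x, (∀ i, l i x = 0) → x = 0) ∧
      ∀ x, ∑ i, ((l i (T x)).re * (l i x).re + (l i (T x)).im * (l i x).im) ≤
        -c * ∑ i, ((l i x).re ^ 2 + (l i x).im ^ 2) := by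
  induction n with
  | zero =>
    intro V _ _ _ T hn hT
    refine ⟨fun _ => 0, 1, one_pos, ?_, ?_⟩
    · intro x _
      have := Module.finrank_zero_iff.mp hn
      exact Subsingleton.elim _ _
    · intro x; simp
  | succ n ih =>
    intro V _ _ _ T hn hT
    have : Nontrivial V := Module.nontrivial_of_finrank_eq_succ hn
    obtain ⟨μ, hμ⟩ := Module.End.exists_eigenvalue T
    obtain ⟨x0, hx0⟩ := hμ.exists_hasEigenvector
    have hx0' : T x0 = μ • x0 := hx0.apply_eq_smul
    have hμre := hT μ x0 hx0.2 hx0'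
    have hninj : ¬ Function.Injective (T - μ • (LinearMap.id : V →ₗ[ℂ] V)) := by
      intro h
      apply hx0.2
      apply h
      simp [hx0']
    have hnsurj : LinearMap.range (T - μ • (LinearMap.id : V →ₗ[ℂ] V)) < ⊤ := by
      rw [lt_top_iff_ne_top]
      intro h
      exact hninj (LinearMap.injective_iff_surjective.mpr (LinearMap.range_eq_top.mp h))
    obtain ⟨f, hf0, hf⟩ := Submodule.exists_le_ker_of_lt_top _ hnsurj
    have hfT : ∀ x, f (T x) = μ * f x := by
      intro x
      have : (T - μ • (LinearMap.id : V →ₗ[ℂ] V)) x ∈ LinearMap.ker f := hf ⟨x, rfl⟩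
      simp [sub_eq_zero] at this
      exact this
    obtain ⟨v, hv⟩ : ∃ v, f v = 1 := by
      obtain ⟨u, hu⟩ : ∃ u, f u ≠ 0 := by
        by_contra! h
        exact hf0 (LinearMap.ext h)
      exact ⟨(f u)⁻¹ • u, by simp [hu]⟩
    have hdim : Module.finrank ℂ (LinearMap.ker f) = n := by
      have := Module.Dual.finrank_ker_add_one_of_ne_zero hf0
      omega
    have hinv : ∀ x ∈ LinearMap.ker f, T x ∈ LinearMap.ker f := by
      intro x hx
      simp only [LinearMap.mem_ker] at *
      rw [hfT, hx, mul_zero]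
    obtain ⟨l, c, hc, hinj, hl⟩ := ih (LinearMap.ker f) (T.restrict hinv) hdim (by
      intro ν x hx h
      refine hT ν x (by simpa using hx) ?_
      have := congrArg Subtype.val h
      simpa using this)
    let π : V →ₗ[ℂ] LinearMap.ker f :=
      LinearMap.codRestrict (LinearMap.ker f) (LinearMap.id - f.smulRight v) (by
        intro x; simp [hv])
    have hπ : ∀ x, ((π x : LinearMap.ker f) : V) = x - f x • v := fun x => rfl
    let w0 : LinearMap.ker f := ⟨T v - μ • v, by simp [hfT, hv]⟩
    have hπT : ∀ x, π (T x) = T.restrict hinv (π x) + f x • w0 := by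
      intro x
      apply Subtype.ext
      simp [hπ, w0, hfT, smul_sub, smul_smul, mul_comm]
    set S0 : ℝ := ∑ i, ((l i w0).re ^ 2 + (l i w0).im ^ 2) with hS0
    have hS0n : 0 ≤ S0 := Finset.sum_nonneg fun i _ => by positivity
    set s : ℝ := -μ.re with hs
    have hspos : 0 < s := by linarith
    obtain ⟨k, hk, hkS⟩ : ∃ k : ℝ, 0 < k ∧ S0 / (2 * c) ≤ k ^ 2 * (s / 2) := by
      refine ⟨Real.sqrt (S0 / (c * s) + 1), Real.sqrt_pos.mpr (by positivity), ?_⟩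
      rw [Real.sq_sqrt (by positivity)]
      have : (S0 / (c * s) + 1) * (s / 2) = S0 / (2 * c) + s / 2 := by field_simp
      linarith
    refine ⟨Fin.cons ((k : ℂ) • f) (fun i => (l i).comp π), min (c / 2) (s / 2),
      by positivity, ?_, ?_⟩
    · intro x hx
      have h0 : f x = 0 := by
        have := hx 0
        simpa [hk.ne'] using this
      have h1 : π x = 0 := hinj _ fun i => by simpa using hx i.succ
      have := hπ x
      rw [h1, h0] at this
      simpa using this.symm
    · intro x
      simp only [Fin.sum_univ_succ, Fin.cons_zero, Fin.cons_succ, LinearMap.smul_apply,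
        LinearMap.comp_apply, hπT, map_add, map_smul, hfT, smul_eq_mul]
      have hl' := hl (π x)
      set p := π x
      set a := f x
      set S := ∑ i, ((l i p).re ^ 2 + (l i p).im ^ 2) with hS
      have hSn : 0 ≤ S := Finset.sum_nonneg fun i _ => by positivity
      have hy : ∑ i, ((a * l i w0).re * (l i p).re + (a * l i w0).im * (l i p).im)
          ≤ c / 2 * S + (a.re ^ 2 + a.im ^ 2) * (S0 / (2 * c)) := by
        rw [hS, hS0, Finset.mul_sum, Finset.sum_div, Finset.mul_sum, ← Finset.sum_add_distrib]
        apply Finset.sum_le_sum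
        intro i _
        generalize l i w0 = q
        generalize l i p = r
        have e : (a.re ^ 2 + a.im ^ 2) * ((q.re ^ 2 + q.im ^ 2) / (2 * c))
          = ((a * q).re ^ 2 + (a * q).im ^ 2) / (2 * c) := by
          simp only [Complex.mul_re, Complex.mul_im]; ring
        rw [e]
        generalize a * q = z
        have e2 : c / 2 * (r.re ^ 2 + r.im ^ 2) + (z.re ^ 2 + z.im ^ 2) / (2 * c)
          - (z.re * r.re + z.im * r.im) = ((c * r.re - z.re) ^ 2 + (c * r.im - z.im) ^ 2) / (2 * c) := by
          field_simp; ring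
        have : 0 ≤ ((c * r.re - z.re) ^ 2 + (c * r.im - z.im) ^ 2) / (2 * c) := by positivity
        linarith
      have hsplit : ∑ i, ((l i (T.restrict hinv p) + a * l i w0).re * (l i p).re
          + (l i (T.restrict hinv p) + a * l i w0).im * (l i p).im)
          = ∑ i, ((l i (T.restrict hinv p)).re * (l i p).re + (l i (T.restrict hinv p)).im * (l i p).im)
          + ∑ i, ((a * l i w0).re * (l i p).re + (a * l i w0).im * (l i p).im) := by
        rw [← Finset.sum_add_distrib]
        apply Finset.sum_congr rfl
        intro i _
        simp only [Complex.add_re, Complex.add_im]; ring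
      rw [hsplit]
      have e0 : (↑k * (μ * a)).re * (↑k * a).re + (↑k * (μ * a)).im * (↑k * a).im
          = - (k ^ 2 * s) * (a.re ^ 2 + a.im ^ 2) := by
        simp [hs]; ring
      have e1 : (↑k * a).re ^ 2 + (↑k * a).im ^ 2 = k ^ 2 * (a.re ^ 2 + a.im ^ 2) := by
        simp; ring
      rw [e0, e1]
      have hN : 0 ≤ a.re ^ 2 + a.im ^ 2 := by positivity
      generalize a.re ^ 2 + a.im ^ 2 = N at *
      have h1 : min (c / 2) (s / 2) * (k ^ 2 * N) ≤ s / 2 * (k ^ 2 * N) :=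
        mul_le_mul_of_nonneg_right (min_le_right _ _) (by positivity)
      have h2 : min (c / 2) (s / 2) * S ≤ c / 2 * S :=
        mul_le_mul_of_nonneg_right (min_le_left _ _) hSn
      have h3 := mul_le_mul_of_nonneg_left hkS hN
      nlinarith

theorem lyap_real (d : ℕ) (M : Matrix (Fin d) (Fin d) ℝ)
    (hM : ∀ μ ∈ spectrum ℂ (M.map (Complex.ofReal)), μ.re < 0) :
    ∃ (G : (Fin d → ℝ) →ₗ[ℝ] EuclideanSpace ℝ (Fin d ⊕ Fin d)) (c : ℝ), 0 < c ∧
      Function.Injective G ∧ ∀ x, inner ℝ (G x) (G (M *ᵥ x)) ≤ -c * ‖G x‖ ^ 2 := by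
  obtain ⟨l, c, hc, hinj, hl⟩ := lyap_functionals d (Fin d → ℂ)
    (Matrix.toLin' (M.map (Complex.ofReal))) (by simp) (by
      intro μ x hx h
      apply hM
      rw [← Matrix.spectrum_toLin', ← Module.End.hasEigenvalue_iff_mem_spectrum]
      exact Module.End.hasEigenvalue_of_hasEigenvector
        ⟨Module.End.mem_eigenspace_iff.mpr h, hx⟩)
  let ι : (Fin d → ℝ) →ₗ[ℝ] (Fin d → ℂ) :=
    { toFun := fun x i => (x i : ℂ)
      map_add' := by intro x y; ext i; simp
      map_smul' := by intro r x; ext i; simp }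
  have hι : ∀ x, ι (M *ᵥ x) = Matrix.toLin' (M.map (Complex.ofReal)) (ι x) := by
    intro x; ext i
    simp [ι, Matrix.mulVec, dotProduct]
  let G : (Fin d → ℝ) →ₗ[ℝ] EuclideanSpace ℝ (Fin d ⊕ Fin d) :=
    { toFun := fun x => WithLp.toLp 2 (Sum.elim (fun i => (l i (ι x)).re) (fun i => (l i (ι x)).im))
      map_add' := by
        intro x y; ext i; rcases i with i | i <;> simp
      map_smul' := by
        intro r x; ext i
        have : ∀ i, l i (r • ι x) = (r : ℂ) * l i (ι x) := by
          intro i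
          have : r • ι x = (r : ℂ) • ι x := by ext j; simp
          rw [this, map_smul, smul_eq_mul]
        rcases i with i | i <;> simp [this] }
  have hG1 : ∀ x i, G x (Sum.inl i) = (l i (ι x)).re := fun x i => rfl
  have hG2 : ∀ x i, G x (Sum.inr i) = (l i (ι x)).im := fun x i => rfl
  refine ⟨G, c, hc, ?_, ?_⟩
  · rw [injective_iff_map_eq_zero]
    intro x hx
    have : ι x = 0 := hinj _ fun i => by
      apply Complex.ext
      · rw [← hG1, hx]; rfl
      · rw [← hG2, hx]; rfl
    ext i
    have := congrFun this i
    simpa [ι] using this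
  · intro x
    have := hl (ι x)
    rw [← hι] at this
    rw [EuclideanSpace.norm_sq_eq, PiLp.inner_apply]
    simp only [Fintype.sum_sum_type, hG1, hG2, Real.norm_eq_abs, sq_abs]
    simpa [Finset.sum_add_distrib] using this

theorem ode_part (d : ℕ) (F : (Fin d → ℝ) → Matrix (Fin d) (Fin d) ℝ) (hF : Continuous F)
    (hM : ∀ μ ∈ spectrum ℂ ((F 0).map (Complex.ofReal)), μ.re < 0) :
    ∃ δ > (0 : ℝ), ∀ y : ℝ → Fin d → ℝ,
      (∀ t : ℝ, 0 ≤ t → HasDerivAt y (F (y t) *ᵥ y t) t) →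
      ‖y 0‖ ≤ δ → Tendsto y atTop (nhds 0) := by
  obtain ⟨G0, c, hc, hinj, hG⟩ := lyap_real d (F 0) hM
  let G : (Fin d → ℝ) →L[ℝ] EuclideanSpace ℝ (Fin d ⊕ Fin d) := LinearMap.toContinuousLinearMap G0
  have hGinj : LinearMap.ker G0 = ⊥ := LinearMap.ker_eq_bot.mpr hinj
  obtain ⟨K0, hK0, hK⟩ := LinearMap.exists_antilipschitzWith G0 hGinj
  set K : ℝ := (K0 : ℝ)
  have hKpos : 0 < K := by exact_mod_cast hK0
  have hKx : ∀ x, ‖x‖ ≤ K * ‖G x‖ := by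
    intro x
    have := hK.le_mul_dist x 0
    simpa [G] using this
  have hGc : ∀ x, inner ℝ (G x) (G (F 0 *ᵥ x)) ≤ -c * ‖G x‖ ^ 2 := hG
  set C : ℝ := ‖G‖ + 1
  have hC : 0 < C := by positivity
  have hCx : ∀ x, ‖G x‖ ≤ C * ‖x‖ := fun x =>
    (G.le_opNorm x).trans (mul_le_mul_of_nonneg_right (by simp [C]) (norm_nonneg _))
  let Λ : Matrix (Fin d) (Fin d) ℝ →ₗ[ℝ] ((Fin d → ℝ) →L[ℝ] (Fin d → ℝ)) :=
    (LinearMap.toContinuousLinearMap.toLinearMap).comp (Matrix.toLin'.toLinearMap)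
  have hΛ : ∀ N x, Λ N x = N *ᵥ x := fun N x => rfl
  have hΛc : Continuous Λ := LinearMap.continuous_of_finiteDimensional _
  have hcont : Continuous fun y => Λ (F y) := hΛc.comp hF
  set η : ℝ := c / (2 * C * K) with hη
  have hηpos : 0 < η := by positivity
  obtain ⟨ε, hε, hεF⟩ := Metric.continuousAt_iff.mp (hcont.continuousAt (x := 0)) η hηpos
  have hrem : ∀ x, ‖x‖ < ε → inner ℝ (G x) (G (F x *ᵥ x)) ≤ -(c / 2) * ‖G x‖ ^ 2 := by
    intro x hx
    have h1 := hεF (x := x) (by simpa using hx)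
    rw [dist_eq_norm] at h1
    have h2 : ‖F x *ᵥ x - F 0 *ᵥ x‖ ≤ η * ‖x‖ := by
      have := (Λ (F x) - Λ (F 0)).le_opNorm x
      simp only [_root_.sub_apply, hΛ] at this
      exact this.trans (mul_le_mul_of_nonneg_right h1.le (norm_nonneg _))
    have h3 : G (F x *ᵥ x) = G (F 0 *ᵥ x) + G (F x *ᵥ x - F 0 *ᵥ x) := by
      rw [← map_add]; congr 1; abel
    rw [h3, inner_add_right]
    have h4 : inner ℝ (G x) (G (F x *ᵥ x - F 0 *ᵥ x)) ≤ c / 2 * ‖G x‖ ^ 2 := by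
      calc inner ℝ (G x) (G (F x *ᵥ x - F 0 *ᵥ x))
          ≤ ‖G x‖ * ‖G (F x *ᵥ x - F 0 *ᵥ x)‖ := real_inner_le_norm _ _
        _ ≤ ‖G x‖ * (C * (η * (K * ‖G x‖))) := by
            gcongr
            exact (hCx _).trans (by gcongr; exact h2.trans (by gcongr; exact hKx x))
        _ = c / 2 * ‖G x‖ ^ 2 := by rw [hη]; field_simp
    have := hGc x
    linarith
  set ρ : ℝ := ε / (2 * K) with hρ
  have hρpos : 0 < ρ := by positivity
  refine ⟨ρ / C, by positivity, ?_⟩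
  intro y hy hy0
  have hv : ∀ t, 0 ≤ t → HasDerivAt (fun t => ‖G (y t)‖ ^ 2)
      (2 * inner ℝ (G (y t)) (G (F (y t) *ᵥ y t))) t := by
    intro t ht
    exact (G.hasFDerivAt.comp_hasDerivAt t (hy t ht)).norm_sq
  have hBd : ∀ t, HasDerivAt (fun t => ρ ^ 2 * Real.exp (-(c / 2) * t))
      (ρ ^ 2 * (Real.exp (-(c / 2) * t) * (-(c / 2)))) t := by
    intro t
    have h := ((hasDerivAt_id t).const_mul (-(c / 2))).exp.const_mul (ρ ^ 2)
    simpa using h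
  have hbound : ∀ t, 0 ≤ t → ‖G (y t)‖ ^ 2 ≤ ρ ^ 2 * Real.exp (-(c / 2) * t) := by
    intro b hb
    refine image_le_of_deriv_right_lt_deriv_boundary (a := 0) (b := b)
      (f := fun t => ‖G (y t)‖ ^ 2)
      (f' := fun t => 2 * inner ℝ (G (y t)) (G (F (y t) *ᵥ y t)))
      (fun t ht => (hv t ht.1).continuousAt.continuousWithinAt)
      (fun t ht => (hv t ht.1).hasDerivWithinAt) ?_ hBd ?_ ⟨hb, le_rfl⟩
    · have : ‖G (y 0)‖ ≤ ρ := by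
        refine (hCx _).trans ?_
        rw [le_div_iff₀ hC] at hy0
        linarith
      simp
      gcongr
    · intro t ht heq
      have hexp := Real.exp_pos (-(c / 2) * t)
      have hexp1 : Real.exp (-(c / 2) * t) ≤ 1 := by
        apply Real.exp_le_one_iff.mpr
        have := mul_nonneg (half_pos hc).le ht.1
        linarith
      have hle : ‖G (y t)‖ ≤ ρ := by
        refine abs_le_of_sq_le_sq' ?_ hρpos.le |>.2
        rw [heq]
        exact mul_le_of_le_one_right (by positivity) hexp1
      have hsmall : ‖y t‖ < ε := by
        calc ‖y t‖ ≤ K * ‖G (y t)‖ := hKx _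
          _ ≤ K * ρ := by gcongr
          _ = ε / 2 := by rw [hρ]; field_simp
          _ < ε := by linarith
      have h := hrem _ hsmall
      rw [heq] at h
      have : 0 < c * (ρ ^ 2 * Real.exp (-(c / 2) * t)) := by positivity
      nlinarith
  have hlim : Tendsto (fun t : ℝ => K * Real.sqrt (ρ ^ 2 * Real.exp (-(c / 2) * t))) atTop (nhds 0) := by
    have h1 : Tendsto (fun t : ℝ => Real.exp (-(c / 2) * t)) atTop (nhds 0) :=
      Real.tendsto_exp_atBot.comp
        (tendsto_id.const_mul_atTop_of_neg (by linarith : -(c / 2) < 0))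
    have h2 := ((h1.const_mul (ρ ^ 2)).sqrt).const_mul K
    simpa using h2
  refine squeeze_zero_norm' ?_ hlim
  filter_upwards [eventually_ge_atTop 0] with t ht
  refine (hKx _).trans ?_
  gcongr
  exact Real.le_sqrt_of_sq_le (hbound t ht)

attribute [local instance] Matrix.normedAddCommGroup Matrix.normedSpace

/-- If the linearized closed-loop matrix `A(0) − B(0)R⁻¹B(0)ᵀP(0)` is Hurwitz, the
origin is locally asymptotically stable for the closed-loop system driven by the
corrected SDRE feedback `ũ_S`. -/
theorem stmt_16 (d m : ℕ)
    (R : Matrix (Fin m) (Fin m) ℝ) (hR : R.PosDef)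
    (A : (Fin d → ℝ) → Matrix (Fin d) (Fin d) ℝ) (hA : Continuous A)
    (B : (Fin d → ℝ) → Matrix (Fin d) (Fin m) ℝ) (hB : Continuous B)
    (P : (Fin d → ℝ) → Matrix (Fin d) (Fin d) ℝ)
    (hP : ContDiff ℝ 1 P) (hPsymm : ∀ y, (P y).IsSymm)
    (φ : (Fin d → ℝ) → Fin d → ℝ)
    (hφ : ∀ y i, φ y i = y ⬝ᵥ (fderiv ℝ P y (Pi.single i 1)).mulVec y)
    (uS : (Fin d → ℝ) → Fin m → ℝ)
    (huS : ∀ y, uS y = -(1 / 2 : ℝ) •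
      (R⁻¹ * (B y)ᵀ).mulVec ((2 : ℝ) • (P y).mulVec y + φ y))
    (hHurwitz : ∀ μ ∈ spectrum ℂ
      ((A 0 - B 0 * R⁻¹ * (B 0)ᵀ * P 0).map (Complex.ofReal)), μ.re < 0) :
    ∃ δ > (0 : ℝ), ∀ y : ℝ → Fin d → ℝ,
      (∀ t : ℝ, 0 ≤ t →
        HasDerivAt y ((A (y t)).mulVec (y t) + (B (y t)).mulVec (uS (y t))) t) →
      ‖y 0‖ ≤ δ → Tendsto y atTop (nhds 0) := by
  let Φ : (Fin d → ℝ) → Matrix (Fin d) (Fin d) ℝ := fun y =>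
    Matrix.of fun i j => ∑ k, y k * (fderiv ℝ P y (Pi.single i 1)) k j
  have hΦ : ∀ y, φ y = Φ y *ᵥ y := by
    intro y
    ext i
    rw [hφ]
    have : Φ y i = y ᵥ* (fderiv ℝ P y (Pi.single i 1)) := by
      ext j; simp [Φ, Matrix.vecMul, dotProduct]
    rw [Matrix.dotProduct_mulVec, ← this]
    rfl
  have hdP : Continuous (fderiv ℝ P) := hP.continuous_fderiv one_ne_zero
  have hΦc : Continuous Φ := by
    refine continuous_matrix fun i j => ?_
    change Continuous fun y : Fin d → ℝ => ∑ k, y k * (fderiv ℝ P y (Pi.single i 1)) k j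
    refine continuous_finsetSum _ fun k _ => ?_
    refine (continuous_apply k).mul ?_
    have h1 : Continuous fun y => fderiv ℝ P y (Pi.single i 1) := hdP.clm_apply continuous_const
    exact (continuous_apply j).comp ((continuous_apply k).comp h1)
  have hΦ0 : Φ 0 = 0 := by ext i j; simp [Φ]
  let F : (Fin d → ℝ) → Matrix (Fin d) (Fin d) ℝ := fun y =>
    A y - B y * R⁻¹ * (B y)ᵀ * P y - (1 / 2 : ℝ) • (B y * R⁻¹ * (B y)ᵀ * Φ y)
  have hFc : Continuous F := by
    have hPc : Continuous P := hP.continuous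
    have hBR : Continuous fun y => B y * R⁻¹ * (B y)ᵀ :=
      (hB.matrix_mul continuous_const).matrix_mul hB.matrix_transpose
    exact (hA.sub (hBR.matrix_mul hPc)).sub ((hBR.matrix_mul hΦc).const_smul (1 / 2 : ℝ))
  have hF0 : F 0 = A 0 - B 0 * R⁻¹ * (B 0)ᵀ * P 0 := by simp [F, hΦ0]
  have hFy : ∀ y, (A y).mulVec y + (B y).mulVec (uS y) = F y *ᵥ y := by
    intro y
    rw [huS, hΦ]
    simp only [F, Matrix.sub_mulVec, Matrix.smul_mulVec, Matrix.mulVec_add, Matrix.mulVec_smul,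
      smul_add, ← Matrix.mulVec_mulVec, smul_smul]
    norm_num
    abel
  obtain ⟨δ, hδ, h⟩ := ode_part d F hFc (by rw [hF0]; exact hHurwitz)
  refine ⟨δ, hδ, fun y hy hy0 => h y (fun t ht => ?_) hy0⟩
  rw [← hFy]
  exact hy t ht
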